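/- For every k ≥ 1: if 0 < s ≤ ξ_{1,r} then Σ_{σ∈Λ_{k,r}} h(σ)^{s/(s+r)} ≥ p_0^{s/(s+r)} · a(s)^{l_{1k}}, and if 0 < s ≤ ξ_{2,r} then Σ_{σ∈Λ_{k,r}} h(σ)^{s/(s+r)} ≥ b(s)^{l_{1k}}. -/

import Mathlib

open MeasureTheory Filter

/-- The `n`-th quantization error of order `r` of a Borel measure `P` on `ℝ^q`:
the infimum of `(∫ d(x,α)^r dP)^{1/r}` over finite sets `α` with `1 ≤ card α ≤ n`. -/
noncomputable def quantErr {q : ℕ} (P : Measure (EuclideanSpace ℝ (Fin q)))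
    (n : ℕ) (r : ℝ) : ℝ :=
  sInf ((fun α : Finset (EuclideanSpace ℝ (Fin q)) =>
      (∫ x, Metric.infDist x (α : Set (EuclideanSpace ℝ (Fin q))) ^ r ∂P) ^ (1 / r)) ''
    {α : Finset (EuclideanSpace ℝ (Fin q)) | α.Nonempty ∧ α.card ≤ n})

/-- Product of weights `g` along a word `σ` (equals `1` for the empty word). -/
noncomputable def prodw {N : ℕ} (g : Fin N → ℝ) (σ : List (Fin N)) : ℝ := (σ.map g).prod

/-- The composition `f_{σ_1} ∘ ⋯ ∘ f_{σ_n}` along a word `σ`. -/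
def wordMap {q N : ℕ} (f : Fin N → EuclideanSpace ℝ (Fin q) → EuclideanSpace ℝ (Fin q))
    (σ : List (Fin N)) : EuclideanSpace ℝ (Fin q) → EuclideanSpace ℝ (Fin q) :=
  σ.foldr (fun i g => f i ∘ g) id

/-- `h(σ) = h^{(1)}(σ) + h^{(2)}(σ)` where
`h^{(1)}(σ) = Σ_{j=0}^{|σ|-1} p0 p_{σ|_j} t_{σ^{(l)}_{-j}} s_σ^r` and `h^{(2)}(σ) = p_σ s_σ^r`. -/
noncomputable def hfun {N : ℕ} (r p0 : ℝ) (s t p : Fin N → ℝ) (σ : List (Fin N)) : ℝ :=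
  (∑ j ∈ Finset.range σ.length, p0 * prodw p (σ.take j) * prodw t (σ.drop j)) * prodw s σ ^ r
    + prodw p σ * prodw s σ ^ r

/-- `η̲_r := min_{1 ≤ i ≤ N} min{p0 t_i + p_i, t_i} · s_i^r`. -/
noncomputable def etaLow {N : ℕ} (r p0 : ℝ) (s t p : Fin N → ℝ) : ℝ :=
  ⨅ i, min (p0 * t i + p i) (t i) * s i ^ r

/-- The finite maximal antichain `Λ_{k,r} = {σ : h(σ|_{|σ|-1}) ≥ η̲_r/k > h(σ)}`. -/
def Lam {N : ℕ} (r p0 : ℝ) (s t p : Fin N → ℝ) (k : ℕ) : Set (List (Fin N)) :=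
  {σ | σ ≠ [] ∧ etaLow r p0 s t p / k ≤ hfun r p0 s t p σ.dropLast ∧
    hfun r p0 s t p σ < etaLow r p0 s t p / k}

/-- `a(x) = Σ_i (t_i s_i^r)^{x/(x+r)}` (also used for `b` with `p` in place of `t`). -/
noncomputable def afun {N : ℕ} (r : ℝ) (s t : Fin N → ℝ) (x : ℝ) : ℝ :=
  ∑ i, (t i * s i ^ r) ^ (x / (x + r))

section Words

variable {N : ℕ}

@[simp] lemma prodw_nil (g : Fin N → ℝ) : prodw g [] = 1 := by simp [prodw]

@[simp] lemma prodw_cons (g : Fin N → ℝ) (i : Fin N) (σ : List (Fin N)) :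
    prodw g (i :: σ) = g i * prodw g σ := by simp [prodw]

@[simp] lemma prodw_append (g : Fin N → ℝ) (σ τ : List (Fin N)) :
    prodw g (σ ++ τ) = prodw g σ * prodw g τ := by simp [prodw]

lemma prodw_pos {g : Fin N → ℝ} (hg : ∀ i, 0 < g i) (σ : List (Fin N)) : 0 < prodw g σ := by
  induction σ with
  | nil => simp
  | cons i σ ih => simpa using mul_pos (hg i) ih

lemma prodw_mul_rpow_rpow {g s : Fin N → ℝ} (hg : ∀ i, 0 < g i) (hs : ∀ i, 0 < s i)
    (r e : ℝ) (σ : List (Fin N)) :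
    (prodw g σ * prodw s σ ^ r) ^ e = prodw (fun i => (g i * s i ^ r) ^ e) σ := by
  induction σ with
  | nil => simp
  | cons i σ ih =>
    have hgσ := prodw_pos hg σ
    have hsσ := prodw_pos hs σ
    have hgi := hg i
    have hsi := hs i
    rw [prodw_cons, prodw_cons, prodw_cons, ← ih, Real.mul_rpow hsi.le hsσ.le,
      mul_mul_mul_comm, Real.mul_rpow (by positivity) (by positivity)]

/-- The words at which a quantity `f` first drops below `ε`. -/
def firstDrop (f : List (Fin N) → ℝ) (ε : ℝ) : Set (List (Fin N)) :=
  {σ | σ ≠ [] ∧ ε ≤ f σ.dropLast ∧ f σ < ε}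

lemma le_pow_length {f : List (Fin N) → ℝ} {c : ℝ} (hc : 0 ≤ c)
    (hf : ∀ σ i, f (σ ++ [i]) ≤ c * f σ) (σ : List (Fin N)) :
    f σ ≤ c ^ σ.length * f [] := by
  induction σ using List.reverseRecOn with
  | nil => simp
  | append_singleton σ i ih =>
    calc f (σ ++ [i]) ≤ c * f σ := hf σ i
      _ ≤ c * (c ^ σ.length * f []) := by gcongr
      _ = c ^ (σ ++ [i]).length * f [] := by
        rw [List.length_append, List.length_singleton, pow_succ]; ring

lemma exists_pow_mul_lt {c ε : ℝ} (hc : 0 ≤ c) (hc1 : c < 1) (hε : 0 < ε) (y : ℝ) :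
    ∃ M : ℕ, c ^ M * y < ε := by
  have h : Tendsto (fun M : ℕ => c ^ M * y) atTop (nhds 0) := by
    simpa using (tendsto_pow_atTop_nhds_zero_of_lt_one hc hc1).mul_const y
  exact (h.eventually_lt_const hε).exists

lemma finite_firstDrop {f : List (Fin N) → ℝ} {c ε : ℝ} (hc : 0 ≤ c) (hc1 : c < 1)
    (hε : 0 < ε) (hf0 : 0 ≤ f []) (hf : ∀ σ i, f (σ ++ [i]) ≤ c * f σ) :
    (firstDrop f ε).Finite := by
  obtain ⟨M, hM⟩ := exists_pow_mul_lt hc hc1 hε (f [])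
  refine (List.finite_length_le (Fin N) M).subset fun σ hσ => ?_
  obtain ⟨-, hσ, -⟩ := hσ
  have hlt : c ^ M * f [] < c ^ σ.dropLast.length * f [] :=
    hM.trans_le (hσ.trans (le_pow_length hc hf _))
  by_contra! hlen
  have hlen : M < σ.length := by simpa using hlen
  have : c ^ σ.dropLast.length ≤ c ^ M :=
    pow_le_pow_of_le_one hc hc1.le (by rw [List.length_dropLast]; omega)
  exact absurd hlt (not_lt.mpr (by gcongr))

/-- Below a word that has not yet dropped, the first-drop words carry at least the mass
`(∑ i, w i) ^ (m - |τ|)`, where `m` bounds the length of all first-drop words from below. -/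
lemma exists_finset_le_sum_prodw {f : List (Fin N) → ℝ} {c ε : ℝ}
    (hc : 0 ≤ c) (hf : ∀ σ i, f (σ ++ [i]) ≤ c * f σ)
    {w : Fin N → ℝ} (hw : ∀ i, 0 ≤ w i) (hw1 : 1 ≤ ∑ i, w i)
    {m : ℕ} (hm : ∀ σ ∈ firstDrop f ε, m ≤ σ.length)
    (M : ℕ) (τ : List (Fin N)) (hτ : ε ≤ f τ) (hM : c ^ M * f τ < ε) :
    ∃ G : Finset (List (Fin N)), (∀ σ ∈ G, τ ++ σ ∈ firstDrop f ε) ∧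
      (∑ i, w i) ^ (m - τ.length) ≤ ∑ σ ∈ G, prodw w σ := by
  classical
  induction M generalizing τ with
  | zero => exact absurd hM (by simpa using hτ)
  | succ M ih =>
    have key : ∀ i, ∃ G : Finset (List (Fin N)), (∀ σ ∈ G, τ ++ i :: σ ∈ firstDrop f ε) ∧
        (∑ i, w i) ^ (m - (τ.length + 1)) ≤ ∑ σ ∈ G, prodw w σ := by
      intro i
      rcases lt_or_ge (f (τ ++ [i])) ε with hlt | hge
      · have hmem : τ ++ [i] ∈ firstDrop f ε := ⟨by simp, by simpa using hτ, hlt⟩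
        have hlen := hm _ hmem
        rw [List.length_append, List.length_singleton] at hlen
        exact ⟨{[]}, by simpa using hmem, by simp [Nat.sub_eq_zero_of_le hlen]⟩
      · obtain ⟨G, hG, hsum⟩ := ih (τ ++ [i]) hge <| by
          calc c ^ M * f (τ ++ [i]) ≤ c ^ M * (c * f τ) := by gcongr; exact hf τ i
            _ = c ^ (M + 1) * f τ := by ring
            _ < ε := hM
        exact ⟨G, by simpa using hG, by simpa using hsum⟩
    choose G hG hsum using key
    refine ⟨Finset.univ.biUnion fun i => (G i).image (List.cons i), ?_, ?_⟩
    · intro σ hσ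
      simp only [Finset.mem_biUnion, Finset.mem_univ, true_and, Finset.mem_image] at hσ
      obtain ⟨i, σ, hσ, rfl⟩ := hσ
      exact hG i σ hσ
    · rw [Finset.sum_biUnion]
      · calc (∑ i, w i) ^ (m - τ.length)
            ≤ (∑ i, w i) ^ (m - (τ.length + 1) + 1) := pow_le_pow_right₀ hw1 (by omega)
          _ = ∑ i, w i * (∑ i, w i) ^ (m - (τ.length + 1)) := by
            rw [pow_succ', Finset.sum_mul]
          _ ≤ ∑ i, w i * ∑ σ ∈ G i, prodw w σ :=
            Finset.sum_le_sum fun i _ => mul_le_mul_of_nonneg_left (hsum i) (hw i)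
          _ = ∑ i, ∑ σ ∈ (G i).image (List.cons i), prodw w σ := by
            refine Finset.sum_congr rfl fun i _ => ?_
            rw [Finset.sum_image fun _ _ _ _ h => List.tail_eq_of_cons_eq h, Finset.mul_sum]
            simp
      · intro i _ j _ hij
        simp only [Function.onFun, Finset.disjoint_left, Finset.mem_image]
        rintro _ ⟨σ, -, rfl⟩ ⟨τ, -, h⟩
        exact hij (List.head_eq_of_cons_eq h).symm

lemma one_le_afun {r : ℝ} (hr : 0 < r) {s g : Fin N → ℝ} (hs : ∀ i, s i ∈ Set.Ioo (0 : ℝ) 1)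
    (hg : ∀ i, 0 < g i) (hg1 : ∀ i, g i ≤ 1) {x ξ : ℝ} (hx : 0 < x) (hxξ : x ≤ ξ)
    (hξ : afun r s g ξ = 1) : 1 ≤ afun r s g x := by
  rw [← hξ]
  refine Finset.sum_le_sum fun i _ => ?_
  have hsr : 0 < s i ^ r := Real.rpow_pos_of_pos (hs i).1 r
  refine Real.rpow_le_rpow_of_exponent_ge (mul_pos (hg i) hsr)
    (mul_le_one₀ (hg1 i) hsr.le (Real.rpow_le_one (hs i).1.le (hs i).2.le hr.le)) ?_
  rw [div_le_div_iff₀ (by positivity) (by linarith)]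
  nlinarith

variable {r p0 : ℝ} {s t p : Fin N → ℝ}

@[simp] lemma hfun_nil : hfun r p0 s t p [] = 1 := by simp [hfun]

lemma mul_prodw_nonneg (hp0 : 0 < p0) (ht : ∀ i, 0 < t i) (hp : ∀ i, 0 < p i)
    (σ τ : List (Fin N)) : 0 ≤ p0 * prodw p σ * prodw t τ :=
  mul_nonneg (mul_nonneg hp0.le (prodw_pos hp σ).le) (prodw_pos ht τ).le

lemma hfun_append_singleton_le (hs : ∀ i, 0 < s i) (ht : ∀ i, 0 < t i) (hp0 : 0 < p0)
    (hp : ∀ i, 0 < p i) (ht1 : ∀ i, t i ≤ 1) (hp1 : ∀ i, p0 + p i ≤ 1)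
    (σ : List (Fin N)) (i : Fin N) :
    hfun r p0 s t p (σ ++ [i]) ≤ s i ^ r * hfun r p0 s t p σ := by
  have hsum : ∑ j ∈ Finset.range σ.length,
      p0 * prodw p ((σ ++ [i]).take j) * prodw t ((σ ++ [i]).drop j) =
      t i * ∑ j ∈ Finset.range σ.length, p0 * prodw p (σ.take j) * prodw t (σ.drop j) := by
    rw [Finset.mul_sum]
    refine Finset.sum_congr rfl fun j hj => ?_
    have hj := (Finset.mem_range.mp hj).le
    rw [List.take_append_of_le_length hj, List.drop_append_of_le_length hj, prodw_append]
    simp only [prodw_cons, prodw_nil]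
    ring
  have hS : 0 ≤ ∑ j ∈ Finset.range σ.length, p0 * prodw p (σ.take j) * prodw t (σ.drop j) :=
    Finset.sum_nonneg fun j _ => mul_prodw_nonneg hp0 ht hp _ _
  have hP := prodw_pos hp σ
  have hsσ := prodw_pos hs σ
  have hsr : 0 < s i ^ r := Real.rpow_pos_of_pos (hs i) r
  simp only [hfun, List.length_append, List.length_singleton, Finset.sum_range_succ, hsum,
    List.take_left, List.drop_left, prodw_append, prodw_cons, prodw_nil, mul_one]
  rw [Real.mul_rpow hsσ.le (hs i).le, ← add_mul, ← add_mul]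
  generalize ∑ j ∈ Finset.range σ.length, p0 * prodw p (σ.take j) * prodw t (σ.drop j) = S at *
  have hW : 0 < prodw s σ ^ r * s i ^ r := by positivity
  have hle : t i * S + p0 * prodw p σ * t i + prodw p σ * p i ≤ S + prodw p σ := by
    have h1 : t i * S ≤ S := mul_le_of_le_one_left hS (ht1 i)
    have h2 : p0 * t i ≤ p0 := mul_le_of_le_one_right hp0.le (ht1 i)
    have h3 : prodw p σ * (p0 * t i + p i) ≤ prodw p σ :=
      mul_le_of_le_one_right hP.le (by linarith [hp1 i])
    linarith
  calc _ ≤ (S + prodw p σ) * (prodw s σ ^ r * s i ^ r) := by gcongr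
    _ = _ := by ring

lemma prodw_mul_rpow_le_hfun (hs : ∀ i, 0 < s i) (ht : ∀ i, 0 < t i) (hp0 : 0 < p0)
    (hp : ∀ i, 0 < p i) (σ : List (Fin N)) :
    prodw p σ * prodw s σ ^ r ≤ hfun r p0 s t p σ :=
  le_add_of_nonneg_left <| mul_nonneg
    (Finset.sum_nonneg fun _ _ => mul_prodw_nonneg hp0 ht hp _ _)
    (Real.rpow_nonneg (prodw_pos hs σ).le r)

lemma mul_prodw_mul_rpow_le_hfun (hs : ∀ i, 0 < s i) (ht : ∀ i, 0 < t i) (hp0 : 0 < p0)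
    (hp : ∀ i, 0 < p i) {σ : List (Fin N)} (hσ : σ ≠ []) :
    p0 * (prodw t σ * prodw s σ ^ r) ≤ hfun r p0 s t p σ := by
  have hW : 0 ≤ prodw s σ ^ r := Real.rpow_nonneg (prodw_pos hs σ).le r
  have hfirst : p0 * prodw t σ ≤
      ∑ j ∈ Finset.range σ.length, p0 * prodw p (σ.take j) * prodw t (σ.drop j) := by
    simpa using Finset.single_le_sum (f := fun j => p0 * prodw p (σ.take j) * prodw t (σ.drop j))
      (fun j _ => mul_prodw_nonneg hp0 ht hp _ _)
      (Finset.mem_range.mpr (List.length_pos_iff.mpr hσ))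
  rw [← mul_assoc]
  exact (mul_le_mul_of_nonneg_right hfirst hW).trans
    (le_add_of_nonneg_right (mul_nonneg (prodw_pos hp σ).le hW))

lemma etaLow_pos [Nonempty (Fin N)] (hs : ∀ i, 0 < s i) (ht : ∀ i, 0 < t i) (hp0 : 0 < p0)
    (hp : ∀ i, 0 < p i) : 0 < etaLow r p0 s t p := by
  obtain ⟨i, hi⟩ := exists_eq_ciInf_of_finite
    (f := fun i => min (p0 * t i + p i) (t i) * s i ^ r)
  rw [etaLow, ← hi]
  exact mul_pos (lt_min (add_pos (mul_pos hp0 (ht i)) (hp i)) (ht i)) (Real.rpow_pos_of_pos (hs i) r)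

lemma etaLow_le_one [Nonempty (Fin N)] (hr : 0 < r) (hs : ∀ i, s i ∈ Set.Ioo (0 : ℝ) 1)
    (ht1 : ∀ i, t i ≤ 1) : etaLow r p0 s t p ≤ 1 := by
  obtain ⟨i⟩ := ‹Nonempty (Fin N)›
  exact (ciInf_le (Set.finite_range _).bddBelow i).trans <|
    mul_le_one₀ ((min_le_right _ _).trans (ht1 i)) (Real.rpow_nonneg (hs i).1.le r)
      (Real.rpow_le_one (hs i).1.le (hs i).2.le hr.le)

lemma mul_afun_pow_le_finsum_hfun [Nonempty (Fin N)] (hr : 0 < r)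
    (hs : ∀ i, s i ∈ Set.Ioo (0 : ℝ) 1) (ht : ∀ i, 0 < t i) (ht1 : ∀ i, t i ≤ 1)
    (hp0 : 0 < p0) (hp : ∀ i, 0 < p i) (hp1 : ∀ i, p0 + p i ≤ 1)
    {g : Fin N → ℝ} (hg : ∀ i, 0 < g i) {C : ℝ} (hC : 0 ≤ C)
    (hgh : ∀ σ ≠ [], C * (prodw g σ * prodw s σ ^ r) ≤ hfun r p0 s t p σ)
    {k : ℕ} (hk : 1 ≤ k) {x : ℝ} (hx : 0 < x) (hA : 1 ≤ afun r s g x) :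
    C ^ (x / (x + r)) * afun r s g x ^ sInf (List.length '' Lam r p0 s t p k)
      ≤ ∑ᶠ σ ∈ Lam r p0 s t p k, hfun r p0 s t p σ ^ (x / (x + r)) := by
  have hs0 : ∀ i, 0 < s i := fun i => (hs i).1
  have hk1 : (1 : ℝ) ≤ k := by exact_mod_cast hk
  have hε : 0 < etaLow r p0 s t p / k :=
    div_pos (etaLow_pos hs0 ht hp0 hp) (by linarith)
  have hε1 : etaLow r p0 s t p / k ≤ 1 :=
    div_le_one_of_le₀ ((etaLow_le_one hr hs ht1).trans hk1) (by linarith)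
  obtain ⟨i₀, hi₀⟩ := Finite.exists_max fun i => s i ^ r
  have hc : 0 ≤ s i₀ ^ r := Real.rpow_nonneg (hs0 i₀).le r
  have hc1 : s i₀ ^ r < 1 := Real.rpow_lt_one (hs0 i₀).le (hs i₀).2 hr
  have hh0 : ∀ σ, 0 ≤ hfun r p0 s t p σ := fun σ =>
    (mul_nonneg (prodw_pos hp σ).le (Real.rpow_nonneg (prodw_pos hs0 σ).le r)).trans
      (prodw_mul_rpow_le_hfun hs0 ht hp0 hp σ)
  have hstep : ∀ σ i, hfun r p0 s t p (σ ++ [i]) ≤ s i₀ ^ r * hfun r p0 s t p σ :=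
    fun σ i => (hfun_append_singleton_le hs0 ht hp0 hp ht1 hp1 σ i).trans
      (mul_le_mul_of_nonneg_right (hi₀ i) (hh0 σ))
  have hfin : (Lam r p0 s t p k).Finite :=
    finite_firstDrop hc hc1 hε (hh0 []) hstep
  obtain ⟨M, hM⟩ := exists_pow_mul_lt hc hc1 hε (hfun r p0 s t p [])
  obtain ⟨G, hG, hsum⟩ := exists_finset_le_sum_prodw
    (w := fun i => (g i * s i ^ r) ^ (x / (x + r)))
    (m := sInf (List.length '' Lam r p0 s t p k)) hc hstep
    (fun i => Real.rpow_nonneg (mul_nonneg (hg i).le (Real.rpow_nonneg (hs0 i).le r)) _) hA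
    (fun σ hσ => Nat.sInf_le ⟨σ, hσ, rfl⟩) M [] (by simpa using hε1) hM
  have hGL : ∀ σ ∈ G, σ ∈ Lam r p0 s t p k := hG
  calc C ^ (x / (x + r)) * afun r s g x ^ sInf (List.length '' Lam r p0 s t p k)
      ≤ C ^ (x / (x + r)) * ∑ σ ∈ G, prodw (fun i => (g i * s i ^ r) ^ (x / (x + r))) σ :=
        mul_le_mul_of_nonneg_left hsum (Real.rpow_nonneg hC _)
    _ ≤ ∑ σ ∈ G, hfun r p0 s t p σ ^ (x / (x + r)) := by
        rw [Finset.mul_sum]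
        refine Finset.sum_le_sum fun σ hσ => ?_
        have hnn : 0 ≤ prodw g σ * prodw s σ ^ r :=
          mul_nonneg (prodw_pos hg σ).le (Real.rpow_nonneg (prodw_pos hs0 σ).le r)
        rw [← prodw_mul_rpow_rpow hg hs0, ← Real.mul_rpow hC hnn]
        exact Real.rpow_le_rpow (mul_nonneg hC hnn) (hgh σ (hGL σ hσ).1) (by positivity)
    _ ≤ ∑ σ ∈ hfin.toFinset, hfun r p0 s t p σ ^ (x / (x + r)) :=
        Finset.sum_le_sum_of_subset_of_nonneg (fun σ hσ => hfin.mem_toFinset.mpr (hGL σ hσ))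
          fun σ _ _ => Real.rpow_nonneg (hh0 σ) _
    _ = ∑ᶠ σ ∈ Lam r p0 s t p k, hfun r p0 s t p σ ^ (x / (x + r)) :=
        (finsum_mem_eq_finite_toFinset_sum _ hfin).symm

end Words

/-- Lemma (Zhu): for every `k ≥ 1`, if `0 < s ≤ ξ_{1,r}` then
`Σ_{σ∈Λ_{k,r}} h(σ)^{s/(s+r)} ≥ p_0^{s/(s+r)} a(s)^{l_{1k}}`, and if `0 < s ≤ ξ_{2,r}` then
`Σ_{σ∈Λ_{k,r}} h(σ)^{s/(s+r)} ≥ b(s)^{l_{1k}}`. -/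
theorem sum_h_pow_over_antichain_lower_bounds
    (N : ℕ) (hN : 2 ≤ N) (r : ℝ) (hr : 0 < r)
    (s : Fin N → ℝ) (hs : ∀ i, s i ∈ Set.Ioo (0 : ℝ) 1)
    (t : Fin N → ℝ) (ht : ∀ i, 0 < t i) (ht1 : ∑ i, t i = 1)
    (p0 : ℝ) (p : Fin N → ℝ) (hp0 : 0 < p0) (hp : ∀ i, 0 < p i)
    (hp1 : p0 + ∑ i, p i = 1)
    (ξ1 ξ2 : ℝ) (hξ1 : 0 < ξ1) (hξ2 : 0 < ξ2)
    (hξ1e : afun r s t ξ1 = 1) (hξ2e : afun r s p ξ2 = 1)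
    :
    ∀ k : ℕ, 1 ≤ k → ∀ x : ℝ, 0 < x →
      (x ≤ ξ1 →
        p0 ^ (x / (x + r)) * afun r s t x ^ sInf (List.length '' Lam r p0 s t p k)
          ≤ ∑ᶠ σ ∈ Lam r p0 s t p k, hfun r p0 s t p σ ^ (x / (x + r))) ∧
      (x ≤ ξ2 →
        afun r s p x ^ sInf (List.length '' Lam r p0 s t p k)
          ≤ ∑ᶠ σ ∈ Lam r p0 s t p k, hfun r p0 s t p σ ^ (x / (x + r))) := by
  intro k hk x hx
  have : Nonempty (Fin N) := ⟨⟨0, by omega⟩⟩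
  have hs0 : ∀ i, 0 < s i := fun i => (hs i).1
  have hti : ∀ i, t i ≤ 1 := fun i =>
    ht1 ▸ Finset.single_le_sum (fun j _ => (ht j).le) (Finset.mem_univ i)
  have hpi : ∀ i, p0 + p i ≤ 1 := fun i =>
    hp1 ▸ add_le_add_right (Finset.single_le_sum (fun j _ => (hp j).le) (Finset.mem_univ i)) p0
  refine ⟨fun hxξ => ?_, fun hxξ => ?_⟩
  · exact mul_afun_pow_le_finsum_hfun hr hs ht hti hp0 hp hpi ht hp0.le
      (fun σ hσ => mul_prodw_mul_rpow_le_hfun hs0 ht hp0 hp hσ) hk hx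
      (one_le_afun hr hs ht hti hx hxξ hξ1e)
  · simpa using mul_afun_pow_le_finsum_hfun hr hs ht hti hp0 hp hpi hp zero_le_one
      (fun σ _ => by simpa using prodw_mul_rpow_le_hfun hs0 ht hp0 hp σ) hk hx
      (one_le_afun hr hs hp (fun i => by linarith [hpi i]) hx hxξ hξ2e)
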